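/- Let p₁, p₂, p₃, p₄, p₅ be primes greater than 3 such that for each i = 1, 2, 3, 4 there exists k_i ∈ ZMod p_i with k_i ≠ 0 for which the elliptic curve y² = x³ + k_i over F_{p_i} has exactly p_{i+1} points (including the point at infinity). If p₁ ≠ p₃, p₅ ≠ p₃, and p₂ ≠ p₄, then (p₁ : ℤ) − p₂ = p₅ − p₄. -/

import Mathlib

/-- The number of `F_p`-rational points, including the point at infinity, of the elliptic curve
`y² = x³ + k` over `F_p`. -/
noncomputable def Npts (p : ℕ) (k : ZMod p) : ℕ :=
  Nat.card (WeierstrassCurve.Affine.Point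
    (WeierstrassCurve.toAffine ⟨0, 0, 0, 0, k⟩))

/-- Two distinct odd integers `t, t' ≡ 1 (mod 3)` occurring in representations of `4p` by
`x² + 3y²` are related by `t² + t t' + t'² = 3p`. -/
theorem sq_add_mul_add_sq_eq_three_mul {p t t' s s' : ℤ} (hp : Prime p) (hpos : 0 < p)
    (h : 4 * p = t ^ 2 + 3 * s ^ 2) (h' : 4 * p = t' ^ 2 + 3 * s' ^ 2)
    (ht : t % 2 = 1) (ht' : t' % 2 = 1) (ht3 : t % 3 = 1) (ht3' : t' % 3 = 1)
    (hne : t ≠ t') : t ^ 2 + t * t' + t' ^ 2 = 3 * p := by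
  have hodd : ∀ {t s : ℤ}, 4 * p = t ^ 2 + 3 * s ^ 2 → t % 2 = 1 → s % 2 = 1 := by
    intro t s h ht
    by_contra hs
    obtain ⟨a, rfl⟩ : ∃ a, t = 2 * a + 1 := ⟨t / 2, by omega⟩
    obtain ⟨b, rfl⟩ : ∃ b, s = 2 * b := ⟨s / 2, by omega⟩
    ring_nf at h
    omega
  have hp3 : p % 3 = 1 := by
    obtain ⟨a, rfl⟩ : ∃ a, t = 3 * a + 1 := ⟨t / 3, by omega⟩
    ring_nf at h
    omega
  have key : ∀ r : ℤ, 4 * p = t' ^ 2 + 3 * r ^ 2 → p ∣ t * r - t' * s →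
      t ^ 2 + t * t' + t' ^ 2 = 3 * p := by
    rintro r hr ⟨m, hm⟩
    have hs := hodd h ht
    have hr2 := hodd hr ht'
    have hmeven : m % 2 = 0 := by
      by_contra hm2
      have hpodd : p % 2 = 1 := by
        obtain ⟨a, rfl⟩ : ∃ a, t = 2 * a + 1 := ⟨t / 2, by omega⟩
        obtain ⟨b, rfl⟩ : ∃ b, s = 2 * b + 1 := ⟨s / 2, by omega⟩
        have h1 := Int.even_mul_succ_self a
        have h2 := Int.even_mul_succ_self b
        obtain ⟨c, hc⟩ := h1
        obtain ⟨d, hd⟩ := h2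
        have : p = (a * (a + 1)) + 3 * (b * (b + 1)) + 1 := by linarith
        omega
      have h1 : (p * m) % 2 = 1 := by
        rw [Int.mul_emod, hpodd, show m % 2 = 1 by omega]; rfl
      have h2 : (t * r) % 2 = 1 := by rw [Int.mul_emod, ht, hr2]; rfl
      have h3 : (t' * s) % 2 = 1 := by rw [Int.mul_emod, ht', hs]; rfl
      omega
    have hnorm : (t * t' + 3 * s * r) ^ 2 + 3 * (p * m) ^ 2 = 16 * p ^ 2 := by
      rw [← hm]
      linear_combination (-4 * p) * h - (t ^ 2 + 3 * s ^ 2) * hr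
    have hpp : 0 < p ^ 2 := by positivity
    have hm16 : 3 * m ^ 2 ≤ 16 := by
      by_contra hlt
      nlinarith [sq_nonneg (t * t' + 3 * s * r)]
    have hmle : m ≤ 2 := by nlinarith
    have hmge : -2 ≤ m := by nlinarith
    have hp0 : p ≠ 0 := hp.ne_zero
    have hm0 : m = 0 ∨ m ^ 2 = 4 := by
      have : m = 0 ∨ m = 2 ∨ m = -2 := by omega
      rcases this with h | h | h <;> simp [h]
    rcases hm0 with rfl | hm4
    · exfalso
      have h1 : t * r = t' * s := by linarith
      have h2 : p * (r ^ 2 - s ^ 2) = 0 := by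
        have : (t * r) ^ 2 = (t' * s) ^ 2 := by rw [h1]
        linarith [show 4 * (p * (r ^ 2 - s ^ 2)) = (t * r) ^ 2 - (t' * s) ^ 2 by
          linear_combination r ^ 2 * h - s ^ 2 * hr]
      have h3 : r ^ 2 = s ^ 2 := by
        rcases mul_eq_zero.mp h2 with h | h
        · exact absurd h hp0
        · linarith
      have h4 : t ^ 2 = t' ^ 2 := by linarith
      rcases sq_eq_sq_iff_eq_or_eq_neg.mp h4 with h | h
      · exact hne h
      · omega
    · have h1 : (t * t' + 3 * s * r) ^ 2 = (2 * p) ^ 2 := by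
        linear_combination hnorm - 3 * p ^ 2 * hm4
      have htt : (t * t') % 3 = 1 := by rw [Int.mul_emod, ht3, ht3']; rfl
      have h2 : t * t' + 3 * s * r = -(2 * p) := by
        rcases sq_eq_sq_iff_eq_or_eq_neg.mp h1 with h | h
        · rw [mul_assoc] at h; omega
        · exact h
      have h3 : p * (t ^ 2 + t * t' + t' ^ 2) = p * (3 * p) := by
        have : (3 * s * r) ^ 2 = (-(2 * p) - t * t') ^ 2 := by rw [← h2]; ring
        have e : (3 * s * r) ^ 2 = (4 * p - t ^ 2) * (4 * p - t' ^ 2) := by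
          linear_combination (-3 * r ^ 2) * h - (4 * p - t ^ 2) * hr
        linarith
      exact mul_left_cancel₀ hp0 h3
  have hdvd : p ∣ (t * s' - t' * s) * (t * -s' - t' * s) :=
    ⟨-4 * (s' ^ 2 - s ^ 2), by linear_combination s' ^ 2 * h - s ^ 2 * h'⟩
  rcases hp.dvd_or_dvd hdvd with hd | hd
  · exact key s' h' hd
  · exact key (-s') (by rw [h']; ring) hd

open Finset in
/-- A function on a cyclic group of order divisible by three which is invariant under cubes is
determined, as far as its sum is concerned, by its values at `1, g, g²`. -/
theorem IsCyclic.three_mul_sum_eq {G : Type*} [CommGroup G] [Fintype G] {g : G}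
    (hg : ∀ x, x ∈ Subgroup.zpowers g) (h3 : 3 ∣ Fintype.card G) (f : G → ℤ)
    (hf : ∀ u c, f (u * c ^ 3) = f u) :
    3 * ∑ u, f u = Fintype.card G * (f 1 + f g + f (g ^ 2)) := by
  classical
  obtain ⟨n, hn⟩ := h3
  have ho : orderOf g = Fintype.card G := by
    rw [orderOf_eq_card_of_forall_mem_zpowers hg, Nat.card_eq_fintype_card]
  have hrange : ∀ m : ℕ, ∑ i ∈ range (3 * m), f (g ^ i) = m * (f 1 + f g + f (g ^ 2)) := by
    intro m
    induction m with
    | zero => simp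
    | succ m ih =>
      have e0 : f (g ^ (3 * m)) = f 1 := by
        rw [← hf 1 (g ^ m)]; congr 1; rw [← pow_mul, one_mul, mul_comm]
      have e1 : f (g ^ (3 * m + 1)) = f g := by
        rw [← hf g (g ^ m)]; congr 1; rw [← pow_mul, pow_succ', mul_comm m]
      have e2 : f (g ^ (3 * m + 2)) = f (g ^ 2) := by
        rw [← hf (g ^ 2) (g ^ m)]; congr 1; rw [← pow_mul, pow_add, mul_comm m, mul_comm]
      rw [show 3 * (m + 1) = 3 * m + 1 + 1 + 1 by ring, sum_range_succ, sum_range_succ,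
        sum_range_succ, ih, e0, e1, e2]
      push_cast
      ring
  have hsum : ∑ u, f u = ∑ i ∈ range (3 * n), f (g ^ i) := by
    rw [← IsCyclic.image_range_orderOf hg, sum_image, ho, hn]
    intro i hi j hj hij
    exact pow_injOn_Iio_orderOf (by simpa using hi) (by simpa using hj) hij
  rw [hsum, hrange, hn]
  push_cast
  ring

section FiniteField

open Finset

variable {F : Type*} [Field F] [Fintype F] [DecidableEq F]

/-- The sum over the units of a finite field is the full sum without the term at zero. -/
theorem sum_units_eq_sum_sub (f : F → ℤ) : ∑ u : Fˣ, f u = ∑ x, f x - f 0 := by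
  rw [← Fintype.sum_subtype_add_sum_subtype (fun x : F => x ≠ 0) f,
    ← Equiv.sum_comp unitsEquivNeZero (fun x : {x : F // x ≠ 0} => f x)]
  have : ∑ x : {x : F // ¬ x ≠ 0}, f x = f 0 := by
    rw [Fintype.sum_eq_single (⟨0, by simp⟩ : {x : F // ¬ x ≠ 0})]
    rintro ⟨x, hx⟩ h
    exact absurd (Subtype.ext (not_not.mp hx)) h
  rw [this]
  simp

theorem sum_quadraticChar_affine (hF : ringChar F ≠ 2) {a : F} (ha : a ≠ 0) (b : F) :
    ∑ x, quadraticChar F (x * a + b) = 0 := by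
  rw [← quadraticChar_sum_zero hF]
  exact Fintype.sum_equiv ((Equiv.mulRight₀ a ha).trans (Equiv.addRight b)) _ _ (fun x => rfl)

theorem sum_quadraticChar_mul_shift (hF : ringChar F ≠ 2) (a b : F) :
    ∑ k, quadraticChar F (a + k) * quadraticChar F (b + k) =
      if a = b then (Fintype.card F : ℤ) - 1 else -1 := by
  split_ifs with hab
  · subst hab
    rw [Fintype.sum_equiv (Equiv.addLeft a)
      (fun k => quadraticChar F (a + k) * quadraticChar F (a + k))
      (fun k => quadraticChar F k * quadraticChar F k) (fun k => rfl)]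
    have h := sum_units_eq_sum_sub (fun k : F => quadraticChar F k * quadraticChar F k)
    have h1 : ∀ u : Fˣ, quadraticChar F (u : F) * quadraticChar F (u : F) = 1 := fun u => by
      rw [← sq, quadraticChar_sq_one u.ne_zero]
    simp only [h1, quadraticChar_zero, mul_zero, sub_zero, sum_const, card_univ,
      Fintype.card_units, nsmul_eq_mul, mul_one] at h
    rw [← h, Nat.cast_sub Fintype.card_pos, Nat.cast_one]
  · have hc : b - a ≠ 0 := sub_ne_zero.mpr (Ne.symm hab)
    have hJ := jacobiSum_nontrivial_inv (quadraticChar_ne_one hF)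
    rw [(quadraticChar_isQuadratic F).inv, jacobiSum] at hJ
    have hm : quadraticChar F (-1) * quadraticChar F (-1) = 1 := by
      rw [← map_mul]; simp
    have : ∑ k, quadraticChar F (a + k) * quadraticChar F (b + k) =
        ∑ x, quadraticChar F (-1) * (quadraticChar F x * quadraticChar F (1 - x)) := by
      symm
      refine Fintype.sum_equiv ((Equiv.mulRight₀ (-(b - a)) (neg_ne_zero.mpr hc)).trans
        (Equiv.addRight (-a))) _ _ (fun x => ?_)
      have h2 : quadraticChar F ((b - a) ^ 2) = 1 := quadraticChar_sq_one' hc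
      simp only [Equiv.trans_apply, Equiv.mulRight₀_apply, Equiv.coe_addRight]
      rw [← map_mul, ← map_mul, ← map_mul, ← one_mul (quadraticChar F (-1 * _)), ← h2, ← map_mul]
      congr 1
      ring
    rw [this, ← mul_sum, hJ, mul_neg, hm]

theorem card_cube_eq_cube (h3 : 3 ∣ Fintype.card Fˣ) {y : F} (hy : y ≠ 0) :
    #{x : F | x ^ 3 = y ^ 3} = 3 := by
  have : Fact (Nat.Prime 3) := ⟨Nat.prime_three⟩
  obtain ⟨w, hw⟩ := exists_prime_orderOf_dvd_card 3 h3
  have hw3 : (w : F) ^ 3 = 1 := by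
    rw [← Units.val_pow_eq_pow_val, ← hw, pow_orderOf_eq_one, Units.val_one]
  have hw1 : (w : F) ≠ 1 := by
    intro h
    rw [Units.val_eq_one] at h
    simp [h] at hw
  have hw0 : (w : F) ≠ 0 := w.ne_zero
  generalize (w : F) = z at hw3 hw1 hw0
  have hz : z ^ 2 + z + 1 = 0 := by
    have : (z - 1) * (z ^ 2 + z + 1) = 0 := by linear_combination hw3
    exact (mul_eq_zero.mp this).resolve_left (sub_ne_zero.mpr hw1)
  have hz2 : z ^ 2 ≠ 1 := fun h => hw1 (by linear_combination hw3 - z * h)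
  have : ({x : F | x ^ 3 = y ^ 3} : Finset F) = {y, z * y, z ^ 2 * y} := by
    ext x
    simp only [mem_filter, mem_univ, true_and, mem_insert, mem_singleton]
    constructor
    · intro h
      have : (x - y) * ((x - z * y) * (x - z ^ 2 * y)) = 0 := by
        linear_combination h + (-x ^ 2 * y + z * x * y ^ 2) * hz - y ^ 3 * hw3
      rcases mul_eq_zero.mp this with h | h
      · exact .inl (sub_eq_zero.mp h)
      · rcases mul_eq_zero.mp h with h | h
        · exact .inr (.inl (sub_eq_zero.mp h))
        · exact .inr (.inr (sub_eq_zero.mp h))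
    · rintro (rfl | rfl | rfl)
      · rfl
      · rw [mul_pow, hw3, one_mul]
      · rw [mul_pow, ← pow_mul, mul_comm 2 3, pow_mul, hw3, one_pow, one_mul]
  rw [this, card_eq_three]
  refine ⟨_, _, _, ?_, ?_, ?_, rfl⟩
  · exact fun h => hw1 (mul_right_cancel₀ hy (by rw [one_mul]; exact h.symm))
  · exact fun h => hz2 (mul_right_cancel₀ hy (by rw [one_mul]; exact h.symm))
  · intro h
    have h := mul_right_cancel₀ hy h
    apply hw1
    apply mul_left_cancel₀ hw0
    linear_combination -h

/-- The character sum `∑ χ(x³ + k)`, where `χ` is the quadratic character. -/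
noncomputable def cubicCharSum (k : F) : ℤ := ∑ x, quadraticChar F (x ^ 3 + k)

theorem cubicCharSum_mul_cube (k : F) {c : F} (hc : c ≠ 0) :
    cubicCharSum (k * c ^ 3) = quadraticChar F c * cubicCharSum k := by
  have h : quadraticChar F (c ^ 3) = quadraticChar F c := by
    rw [pow_succ, map_mul, quadraticChar_sq_one' hc, one_mul]
  rw [cubicCharSum, cubicCharSum, mul_sum]
  symm
  refine Fintype.sum_equiv (Equiv.mulRight₀ c hc) _ _ (fun x => ?_)
  rw [Equiv.mulRight₀_apply, mul_pow, ← add_mul, map_mul, h, mul_comm]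

theorem cubicCharSum_zero (hF : ringChar F ≠ 2) : cubicCharSum (0 : F) = 0 := by
  rw [← quadraticChar_sum_zero hF, cubicCharSum]
  refine sum_congr rfl fun x _ => ?_
  rcases eq_or_ne x 0 with rfl | hx
  · simp
  · rw [add_zero, pow_succ, map_mul, quadraticChar_sq_one' hx, one_mul]

theorem sum_cubicCharSum_mul_sq (hF : ringChar F ≠ 2) (k : F) :
    ∑ u : Fˣ, cubicCharSum (k * (u : F) ^ 2) = 0 := by
  have h1 : ∀ u : Fˣ, cubicCharSum (k * (u : F) ^ 2) =
      ∑ y, quadraticChar F ((u : F) * y ^ 3 + k) := by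
    intro u
    symm
    refine Fintype.sum_equiv (Equiv.mulRight₀ (u : F) u.ne_zero) _ _ (fun x => ?_)
    rw [Equiv.mulRight₀_apply, show (x * u) ^ 3 + k * (u : F) ^ 2 = (u * x ^ 3 + k) * (u : F) ^ 2
      by ring, map_mul, quadraticChar_sq_one' u.ne_zero, mul_one]
  simp only [h1]
  rw [sum_units_eq_sum_sub (fun u : F => ∑ y, quadraticChar F (u * y ^ 3 + k)), sum_comm,
    Fintype.sum_eq_single 0]
  · simp
  · exact fun y hy => sum_quadraticChar_affine hF (pow_ne_zero 3 hy) k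

theorem sum_cubicCharSum_sq (hF : ringChar F ≠ 2) (h3 : 3 ∣ Fintype.card Fˣ) :
    ∑ k : F, cubicCharSum k ^ 2 = 2 * Fintype.card F * (Fintype.card F - 1) := by
  have h1 : ∀ y : F, ∑ x : F, (if x ^ 3 = y ^ 3 then (Fintype.card F : ℤ) - 1 else -1) =
      if y = 0 then 0 else 2 * (Fintype.card F : ℤ) := by
    intro y
    have e : ∀ x : F, (if x ^ 3 = y ^ 3 then (Fintype.card F : ℤ) - 1 else -1) =
        (if x ^ 3 = y ^ 3 then (Fintype.card F : ℤ) else 0) - 1 := by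
      intro x; split_ifs <;> ring
    simp only [e]
    rw [sum_sub_distrib, ← sum_filter, sum_const, sum_const, card_univ]
    split_ifs with hy
    · subst hy
      simp [filter_eq']
    · rw [card_cube_eq_cube h3 hy]
      simp
      ring
  calc ∑ k : F, cubicCharSum k ^ 2
      = ∑ k : F, ∑ y : F, ∑ x : F, quadraticChar F (x ^ 3 + k) * quadraticChar F (y ^ 3 + k) := by
        refine sum_congr rfl fun k _ => ?_
        rw [sq, cubicCharSum, sum_mul_sum, sum_comm]
    _ = ∑ y : F, ∑ x : F, ∑ k : F, quadraticChar F (x ^ 3 + k) * quadraticChar F (y ^ 3 + k) := by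
        rw [sum_comm]
        exact sum_congr rfl fun y _ => sum_comm
    _ = ∑ y : F, if y = 0 then 0 else 2 * (Fintype.card F : ℤ) := by
        simp only [sum_quadraticChar_mul_shift hF, h1]
    _ = 2 * Fintype.card F * (Fintype.card F - 1) := by
        have h := sum_units_eq_sum_sub (fun y : F => if y = 0 then 0 else 2 * (Fintype.card F : ℤ))
        simp only [Units.ne_zero, if_false, if_true, sum_const, card_univ, Fintype.card_units,
          sub_zero, nsmul_eq_mul] at h
        rw [← h, Nat.cast_sub Fintype.card_pos, Nat.cast_one]
        ring

/-- If `q ≡ 1 (mod 3)` and `t` is the trace of a curve `y² = x³ + k`, then `4q - t²` is three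
times a square. -/
theorem exists_four_mul_card_eq (hF : ringChar F ≠ 2) (h3 : 3 ∣ Fintype.card Fˣ) {k : F}
    (hk : k ≠ 0) : ∃ s : ℤ, 4 * (Fintype.card F : ℤ) = cubicCharSum k ^ 2 + 3 * s ^ 2 := by
  obtain ⟨g, hg⟩ := IsCyclic.exists_generator (α := Fˣ)
  have hχ : ∀ c : Fˣ, quadraticChar F (c : F) ^ 2 = 1 := fun c => quadraticChar_sq_one c.ne_zero
  have hA := IsCyclic.three_mul_sum_eq hg h3 (fun u => cubicCharSum (k * (u : F) ^ 2)) (by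
    intro u c
    have : k * ((u * c ^ 3 : Fˣ) : F) ^ 2 = k * (u : F) ^ 2 * ((c : F) ^ 2) ^ 3 := by
      push_cast; ring
    simp only [this]
    rw [cubicCharSum_mul_cube _ (pow_ne_zero 2 c.ne_zero), quadraticChar_sq_one' c.ne_zero,
      one_mul])
  have hB := IsCyclic.three_mul_sum_eq hg h3 (fun u => cubicCharSum (k * (u : F)) ^ 2) (by
    intro u c
    have : k * ((u * c ^ 3 : Fˣ) : F) = k * (u : F) * (c : F) ^ 3 := by
      push_cast; ring
    simp only [this]
    rw [cubicCharSum_mul_cube _ c.ne_zero, mul_pow, hχ, one_mul])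
  have hn : (Fintype.card Fˣ : ℤ) = Fintype.card F - 1 := by
    rw [Fintype.card_units, Nat.cast_sub Fintype.card_pos, Nat.cast_one]
  have hn0 : (Fintype.card Fˣ : ℤ) ≠ 0 := by exact_mod_cast Fintype.card_ne_zero
  have hsq : ∑ u : Fˣ, cubicCharSum (k * (u : F)) ^ 2 =
      2 * Fintype.card F * (Fintype.card F - 1) := by
    rw [sum_units_eq_sum_sub (fun u : F => cubicCharSum (k * u) ^ 2), mul_zero,
      cubicCharSum_zero hF, ← sum_cubicCharSum_sq hF h3]
    simp only [ne_eq, OfNat.ofNat_ne_zero, not_false_eq_true, zero_pow, sub_zero]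
    exact Fintype.sum_equiv (Equiv.mulLeft₀ k hk) _ _ (fun x => rfl)
  have h4 : cubicCharSum (k * (g : F)) ^ 2 = cubicCharSum (k * (g : F) ^ 4) ^ 2 := by
    rw [show k * (g : F) ^ 4 = k * g * (g : F) ^ 3 by ring, cubicCharSum_mul_cube _ g.ne_zero,
      mul_pow, hχ, one_mul]
  rw [sum_cubicCharSum_mul_sq hF] at hA
  rw [hsq] at hB
  simp only [Units.val_one, one_pow, mul_one, Units.val_pow_eq_pow_val, ← pow_mul,
    Nat.reduceMul, h4] at hA hB
  generalize cubicCharSum k = A at *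
  generalize cubicCharSum (k * (g : F) ^ 2) = B at *
  generalize cubicCharSum (k * (g : F) ^ 4) = C at *
  rw [← hn] at hB
  have hsum : A + B + C = 0 := by
    rw [mul_zero, zero_eq_mul] at hA
    exact hA.resolve_left hn0
  have hsumsq : A ^ 2 + B ^ 2 + C ^ 2 = 6 * Fintype.card F := by
    apply mul_left_cancel₀ hn0
    linear_combination -hB
  have h12 : (A + 2 * B) ^ 2 = 3 * (4 * Fintype.card F - A ^ 2) := by
    obtain rfl : C = -A - B := by linarith
    linear_combination 2 * hsumsq
  obtain ⟨s, hs⟩ := Int.prime_three.dvd_of_dvd_pow (Dvd.intro _ h12.symm)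
  exact ⟨s, by rw [hs] at h12; linarith⟩

theorem cubicCharSum_eq_zero (hF : ringChar F ≠ 2)
    (h3 : ¬ 3 ∣ Fintype.card Fˣ) (k : F) : cubicCharSum k = 0 := by
  have hco : (Fintype.card Fˣ).Coprime 3 :=
    ((Nat.Prime.coprime_iff_not_dvd Nat.prime_three).mpr h3).symm
  have hinj : Function.Injective (fun x : F => x ^ 3) := by
    intro x y hxy
    simp only at hxy
    rcases eq_or_ne x 0 with rfl | hx
    · rw [zero_pow three_ne_zero] at hxy
      exact (pow_eq_zero_iff three_ne_zero).mp hxy.symm |>.symm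
    · have hy : y ≠ 0 := by
        rintro rfl
        exact hx ((pow_eq_zero_iff three_ne_zero).mp (hxy.trans (zero_pow three_ne_zero)))
      have := (powCoprime (G := Fˣ) (n := 3) (by rwa [Nat.card_eq_fintype_card])).injective
        (a₁ := Units.mk0 x hx) (a₂ := Units.mk0 y hy) (by
          rw [powCoprime_apply, powCoprime_apply]
          exact Units.ext (by simpa using hxy))
      simpa using congrArg Units.val this
  rw [← quadraticChar_sum_zero hF, cubicCharSum]
  exact Fintype.sum_equiv ((Equiv.ofBijective _ (Finite.injective_iff_bijective.mp hinj)).trans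
    (Equiv.addRight k)) _ _ (fun x => rfl)

/-- The number of points of `y² = x³ + k` in terms of the character sum. -/
theorem card_point_eq (hF : ringChar F ≠ 2) (h3 : (3 : F) ≠ 0) {k : F} (hk : k ≠ 0) :
    (Nat.card (WeierstrassCurve.Affine.Point
      (WeierstrassCurve.toAffine (⟨0, 0, 0, 0, k⟩ : WeierstrassCurve F))) : ℤ) =
      Fintype.card F + 1 + cubicCharSum k := by
  have h2 : (2 : F) ≠ 0 := Ring.two_ne_zero hF
  have hΔ : (⟨0, 0, 0, 0, k⟩ : WeierstrassCurve F).Δ ≠ 0 := by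
    have : (⟨0, 0, 0, 0, k⟩ : WeierstrassCurve F).Δ = -(2 ^ 4 * 3 ^ 3 * k ^ 2) := by
      simp only [WeierstrassCurve.Δ, WeierstrassCurve.b₂, WeierstrassCurve.b₄,
        WeierstrassCurve.b₆, WeierstrassCurve.b₈]
      ring
    rw [this]
    simp [h2, h3, hk]
  have hiff : ∀ z : F × F, (WeierstrassCurve.toAffine
      (⟨0, 0, 0, 0, k⟩ : WeierstrassCurve F)).Nonsingular z.1 z.2 ↔ z.2 ^ 2 = z.1 ^ 3 + k := by
    intro z
    rw [← WeierstrassCurve.Affine.equation_iff_nonsingular_of_Δ_ne_zero hΔ,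
      WeierstrassCurve.Affine.equation_iff]
    simp
  have e : WeierstrassCurve.Affine.Point (WeierstrassCurve.toAffine
      (⟨0, 0, 0, 0, k⟩ : WeierstrassCurve F)) ≃
        Option (Σ x : F, {y : F // y ^ 2 = x ^ 3 + k}) :=
    (WeierstrassCurve.Affine.nonsingularPointEquiv _).trans
      (Equiv.optionCongr ((Equiv.subtypeEquivRight hiff).trans
        (Equiv.subtypeProdEquivSigmaSubtype fun x y : F => y ^ 2 = x ^ 3 + k)))
  have hcard : ∀ x : F, (Fintype.card {y : F // y ^ 2 = x ^ 3 + k} : ℤ) =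
      quadraticChar F (x ^ 3 + k) + 1 := by
    intro x
    rw [← quadraticChar_card_sqrts hF, Set.toFinset_card]
    congr 1
  rw [Nat.card_congr e, Nat.card_eq_fintype_card, Fintype.card_option, Fintype.card_sigma]
  push_cast
  simp only [hcard, sum_add_distrib, cubicCharSum, sum_const, card_univ, nsmul_eq_mul, mul_one]
  ring

end FiniteField

/-- The arithmetic constraints satisfied by the trace `p + 1 - q` of a curve `y² = x³ + k` over
`F_p` with a prime number `q` of points. -/
def TraceCondition (p q : ℕ) : Prop :=
  (∃ s : ℤ, 4 * (p : ℤ) = ((p : ℤ) + 1 - q) ^ 2 + 3 * s ^ 2) ∧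
    ((p : ℤ) + 1 - q) % 2 = 1 ∧ ((p : ℤ) + 1 - q) % 3 = 1

theorem TraceCondition.of_Npts_eq {p q : ℕ} (hp : p.Prime) (hq : q.Prime) (hp3 : 3 < p) (hq3 : 3 < q)
    (h : ∃ k : ZMod p, k ≠ 0 ∧ Npts p k = q) : TraceCondition p q := by
  have : Fact p.Prime := ⟨hp⟩
  obtain ⟨k, hk, hN⟩ := h
  have hF : ringChar (ZMod p) ≠ 2 := by rw [ZMod.ringChar_zmod_n]; omega
  have h3 : (3 : ZMod p) ≠ 0 := by
    intro h0
    have : ((3 : ℕ) : ZMod p) = 0 := by exact_mod_cast h0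
    exact absurd (Nat.le_of_dvd (by norm_num) ((ZMod.natCast_eq_zero_iff 3 p).mp this)) (by omega)
  have hcard := card_point_eq hF h3 hk
  rw [← Npts, hN, ZMod.card] at hcard
  have hp2 : p % 2 = 1 := hp.eq_two_or_odd.resolve_left (by omega)
  have hq2 : q % 2 = 1 := hq.eq_two_or_odd.resolve_left (by omega)
  have hqm : q % 3 ≠ 0 := fun h0 => by
    have := (Nat.prime_dvd_prime_iff_eq Nat.prime_three hq).mp (Nat.dvd_of_mod_eq_zero h0)
    omega
  by_cases hdvd : 3 ∣ Fintype.card (ZMod p)ˣ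
  · obtain ⟨s, hs⟩ := exists_four_mul_card_eq hF hdvd hk
    rw [ZMod.card] at hs
    have ht : cubicCharSum k = -((p : ℤ) + 1 - q) := by linarith
    rw [ht, neg_sq] at hs
    refine ⟨⟨s, hs⟩, by omega, ?_⟩
    rw [Fintype.card_units, ZMod.card] at hdvd
    have hpm : p % 3 = 1 := by omega
    have : ((p : ℤ) + 1 - q) % 3 ≠ 0 := by
      intro h0
      obtain ⟨a, ha⟩ := Int.dvd_of_emod_eq_zero h0
      rw [ha] at hs
      have : 4 * (p : ℤ) = 3 * (3 * a ^ 2 + s ^ 2) := by linarith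
      omega
    omega
  · rw [cubicCharSum_eq_zero hF hdvd] at hcard
    omega

/-- The third trace of a chain is determined by the two traces over the middle prime. -/
theorem trace_eq_of_relations {p t t' v : ℤ} (h : t ^ 2 + t * t' + t' ^ 2 = 3 * p)
    (hv : (2 - t) ^ 2 + (2 - t) * v + v ^ 2 = 3 * (p + 1 - t))
    (ht' : t' % 2 = 1) (hv2 : v % 2 = 1) : v = t + t' - 1 := by
  have : (v - (t + t' - 1)) * (v + 1 + t') = 0 := by linear_combination hv - h
  rcases mul_eq_zero.mp this with h | h <;> omega

/-- If `p, r` are distinct neighbours of the prime `q`, then their traces satisfy the relation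
`t² + t t' + t'² = 3q`. -/
theorem TraceCondition.relation {q p r : ℕ} (hq : q.Prime) (hne : p ≠ r)
    (h : TraceCondition q p) (h' : TraceCondition q r) :
    ((q : ℤ) + 1 - p) ^ 2 + ((q : ℤ) + 1 - p) * ((q : ℤ) + 1 - r) + ((q : ℤ) + 1 - r) ^ 2 =
      3 * q := by
  obtain ⟨⟨s, hs⟩, h2, h3⟩ := h
  obtain ⟨⟨s', hs'⟩, h2', h3'⟩ := h'
  exact sq_add_mul_add_sq_eq_three_mul (Nat.prime_iff_prime_int.mp hq) (by exact_mod_cast hq.pos)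
    hs hs' h2 h2' h3 h3' (by omega)

theorem TraceCondition.symm {p q : ℕ} (h : TraceCondition p q) : TraceCondition q p := by
  obtain ⟨⟨s, hs⟩, h2, h3⟩ := h
  exact ⟨⟨s, by linear_combination hs⟩, by omega, by omega⟩

/-- Theorem 3.2: if `(p₁, p₂, p₃, p₄, p₅)` is an elliptic list over `3` (with `j = 0`
representatives) with `p₁ ≠ p₃`, `p₅ ≠ p₃`, `p₂ ≠ p₄`, then `p₁ − p₂ = p₅ − p₄`. -/
theorem stmt_8 (p₁ p₂ p₃ p₄ p₅ : ℕ)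
    (hp₁ : p₁.Prime) (hp₂ : p₂.Prime) (hp₃ : p₃.Prime) (hp₄ : p₄.Prime) (hp₅ : p₅.Prime)
    (h₁3 : 3 < p₁) (h₂3 : 3 < p₂) (h₃3 : 3 < p₃) (h₄3 : 3 < p₄) (h₅3 : 3 < p₅)
    (h₁ : ∃ k : ZMod p₁, k ≠ 0 ∧ Npts p₁ k = p₂)
    (h₂ : ∃ k : ZMod p₂, k ≠ 0 ∧ Npts p₂ k = p₃)
    (h₃ : ∃ k : ZMod p₃, k ≠ 0 ∧ Npts p₃ k = p₄)
    (h₄ : ∃ k : ZMod p₄, k ≠ 0 ∧ Npts p₄ k = p₅)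
    (hne₁ : p₁ ≠ p₃) (hne₂ : p₅ ≠ p₃) (hne₃ : p₂ ≠ p₄) :
    (p₁ : ℤ) - p₂ = (p₅ : ℤ) - p₄ := by
  have t₁ := TraceCondition.symm (TraceCondition.of_Npts_eq hp₁ hp₂ h₁3 h₂3 h₁)
  have t₂ := TraceCondition.of_Npts_eq hp₂ hp₃ h₂3 h₃3 h₂
  have t₃ := TraceCondition.of_Npts_eq hp₃ hp₄ h₃3 h₄3 h₃
  have t₄ := TraceCondition.of_Npts_eq hp₄ hp₅ h₄3 h₅3 h₄
  have r₂ := TraceCondition.relation hp₂ hne₁.symm t₂ t₁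
  have r₃ := TraceCondition.relation hp₃ hne₃ (TraceCondition.symm t₂) t₃
  have r₄ := TraceCondition.relation hp₄ hne₂.symm (TraceCondition.symm t₃) t₄
  have e₁ := trace_eq_of_relations (v := p₂ + 1 - p₁) r₃ (by linear_combination r₂) t₃.2.1 t₁.2.1
  have e₂ := trace_eq_of_relations (t := p₃ + 1 - p₄) (t' := p₃ + 1 - p₂) (v := p₄ + 1 - p₅)
    (p := p₃) (by linear_combination r₃) (by linear_combination r₄) (TraceCondition.symm t₂).2.1 t₄.2.1
  linarith
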